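/- Let S be a finite conformal iterated function system with limit set Λ, ψ a Hölder continuous potential on Σ_I^+ with equilibrium measure μ^+ = μ_ψ, and μ̂ the equilibrium measure of ψ∘π_1 for the skew product Φ on Σ_I^+ × Λ. Let {μ_ω}_{ω∈Σ_I^+} be the conditional measures of μ̂ with respect to the measurable partition into fibers {ω}×Λ of π_1 (viewed as measures on Λ). Then there exists a constant C > 0 such that for μ^+-a.e. ω, η ∈ Σ_I^+ and every Borel set A ⊂ Λ, (1/C)·μ_η(A) ≤ μ_ω(A) ≤ C·μ_η(A). -/

import Mathlib

open MeasureTheory Set Filter Metric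
open scoped NNReal ENNReal Topology

noncomputable section

/-- Euclidean space `ℝ^D`. -/
abbrev EucSp (D : ℕ) := EuclideanSpace ℝ (Fin D)

/-- The one-sided symbolic space `Σ_m^+` on `m` symbols. -/
abbrev SymbSp (m : ℕ) := ℕ → Fin m

/-- The one-sided shift `σ`. -/
def shift {m : ℕ} : SymbSp m → SymbSp m := fun ω n => ω (n + 1)

/-- The word `ω_1 … ω_n` of the first `n` symbols of `ω`. -/
def word {m : ℕ} (ω : SymbSp m) (n : ℕ) : List (Fin m) := (List.range n).map ω

/-- The cylinder `[w_1 … w_n]` on a finite word `w`. -/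
def cyl {m : ℕ} (w : List (Fin m)) : Set (SymbSp m) := {ω | word ω w.length = w}

/-- The composition `φ_{i_1 … i_p} := φ_{i_1} ∘ … ∘ φ_{i_p}`. -/
def compWord {D m : ℕ} (φ : Fin m → EucSp D → EucSp D) : List (Fin m) → EucSp D → EucSp D
  | [] => id
  | i :: w => φ i ∘ compWord φ w

/-- Birkhoff sum `S_n ψ` with respect to the shift. -/
def birk {m : ℕ} (ψ : SymbSp m → ℝ) (n : ℕ) (ω : SymbSp m) : ℝ :=
  ∑ k ∈ Finset.range n, ψ (shift^[k] ω)

/-- Hölder continuity of a potential on the shift space (variation on cylinders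
decays geometrically). -/
def HolderPotential {m : ℕ} (ψ : SymbSp m → ℝ) : Prop :=
  ∃ C > (0 : ℝ), ∃ θ ∈ Ioo (0 : ℝ) 1, ∀ (n : ℕ) (ω η : SymbSp m),
    word ω n = word η n → |ψ ω - ψ η| ≤ C * θ ^ n

/-- The Gibbs property of a measure `μ` for the potential `ψ` with pressure `P`. -/
def IsGibbs {m : ℕ} (ψ : SymbSp m → ℝ) (P : ℝ) (μ : Measure (SymbSp m)) : Prop :=
  ∃ C : ℝ, 1 ≤ C ∧ ∀ (ω : SymbSp m) (n : ℕ),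
    C⁻¹ * Real.exp (birk ψ n ω - n * P) ≤ (μ (cyl (word ω n))).toReal ∧
    (μ (cyl (word ω n))).toReal ≤ C * Real.exp (birk ψ n ω - n * P)

/-- `μ` is the equilibrium (Gibbs) measure of the Hölder potential `ψ` for the
shift, with pressure `P`: it is a shift-invariant probability measure with the
Gibbs property; its entropy then satisfies `h(μ) = P - ∫ ψ dμ`. -/
def IsEquilibrium {m : ℕ} (ψ : SymbSp m → ℝ) (P : ℝ) (μ : Measure (SymbSp m)) : Prop :=
  IsProbabilityMeasure μ ∧ μ.map shift = μ ∧ IsGibbs ψ P μ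

/-- A finite conformal iterated function system of injective contractions of a
compact set `V ⊂ ℝ^D` with nonempty interior. -/
structure CIFS (D m : ℕ) where
  V : Set (EucSp D)
  φ : Fin m → EucSp D → EucSp D
  compactV : IsCompact V
  interiorV : (interior V).Nonempty
  mapsToV : ∀ i, MapsTo (φ i) V V
  injOnV : ∀ i, InjOn (φ i) V
  contraction : ∀ i, ∃ r : ℝ≥0, r < 1 ∧ LipschitzOnWith r (φ i) V
  conformal : ∀ i, ∀ x ∈ V, ConformalAt (φ i) x
  measurable_φ : ∀ i, Measurable (φ i)

/-- The limit set `Λ = ⋃_ω ⋂_n φ_{ω_1…ω_n}(V)`. -/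
def CIFS.limitSet {D m : ℕ} (S : CIFS D m) : Set (EucSp D) :=
  ⋃ ω : SymbSp m, ⋂ n : ℕ, compWord S.φ (word ω n) '' S.V

/-- `π` is the canonical coding map: `π(ω) ∈ φ_{ω_1…ω_n}(V)` for every `n`. -/
def CIFS.IsCoding {D m : ℕ} (S : CIFS D m) (π : SymbSp m → EucSp D) : Prop :=
  ∀ (ω : SymbSp m) (n : ℕ), π ω ∈ compWord S.φ (word ω n) '' S.V

/-- The skew product `Φ(ω,x) = (σω, φ_{ω_1}(x))`. -/
def skew {D m : ℕ} (S : CIFS D m) : SymbSp m × EucSp D → SymbSp m × EucSp D :=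
  fun p => (shift p.1, S.φ (p.1 0) p.2)

/-- `μ̂` is the equilibrium measure of `ψ ∘ π_1` for the skew product `Φ`, lifting
the equilibrium measure `μ⁺` of `ψ`: it is the unique `Φ`-invariant probability
measure on `Σ_m^+ × Λ` with `(π_1)_* μ̂ = μ⁺` (uniqueness holds since `Φ`
contracts the fibers). -/
def CIFS.IsLift {D m : ℕ} (S : CIFS D m) (μplus : Measure (SymbSp m))
    (μhat : Measure (SymbSp m × EucSp D)) : Prop :=
  IsProbabilityMeasure μhat ∧ μhat.map (skew S) = μhat ∧
    μhat.map Prod.fst = μplus ∧ μhat {p | p.2 ∈ S.limitSet}ᶜ = 0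

/-- Parry's Jacobian `J_T(μ)` of a measure `μ` under `T`: `μ(T(A)) = ∫_A J dμ` for
every measurable set `A` on which `T` is injective. The folding entropy is
`F_T(μ) = ∫ log J_T(μ) dμ` and the overlap number is `o = exp (F_T(μ))`. -/
def IsJacobianOf {α : Type*} [MeasurableSpace α] (T : α → α) (μ : Measure α)
    (J : α → ℝ) : Prop :=
  Measurable J ∧ ∀ A : Set α, MeasurableSet A → InjOn T A →
    μ (T '' A) = ENNReal.ofReal (∫ x in A, J x ∂μ)

/-- The stable Lyapunov exponent `χ_s(μ̂) = ∫ log |φ'_{ω_1}(x)| dμ̂(ω,x)`, where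
`|φ'_i(x)|` is the conformal derivative norm `‖(Dφ_i)_x‖`. -/
def CIFS.chiS {D m : ℕ} (S : CIFS D m) (μhat : Measure (SymbSp m × EucSp D)) : ℝ :=
  ∫ p : SymbSp m × EucSp D, Real.log ‖fderiv ℝ (S.φ (p.1 0)) p.2‖ ∂μhat

/-- The Hausdorff dimension `HD(ν)` of a measure: the infimum of the Hausdorff
dimensions of sets of full `ν`-measure. -/
def measDimH {X : Type*} [EMetricSpace X] [MeasurableSpace X] (ν : Measure X) : ℝ≥0∞ :=
  ⨅ (A : Set X) (_ : ν Aᶜ = 0), dimH A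

/-- `ν` is exact dimensional with pointwise dimension `d`: for `ν`-a.e. `x`,
`lim_{r→0} log ν(B(x,r)) / log r = d`. -/
def exactDimensionalWith {X : Type*} [PseudoMetricSpace X] [MeasurableSpace X]
    (ν : Measure X) (d : ℝ) : Prop :=
  ∀ᵐ x ∂ν, Tendsto (fun r : ℝ => Real.log (ν (Metric.ball x r)).toReal / Real.log r)
    (𝓝[>] (0 : ℝ)) (𝓝 d)

/-- `κ` is the system of Rokhlin conditional measures `{μ_ω}` of `μ̂` with respect
to the partition into fibers `{ω} × Λ` of `π_1`, viewed as measures on `Λ ⊆ ℝ^D`: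
for `μ⁺`-a.e. `ω` and every Borel `A`,
`μ_ω(A) = lim_n μ̂([ω_1…ω_n] × A) / μ⁺([ω_1…ω_n])`. -/
def IsCondSystem {D m : ℕ} (μplus : Measure (SymbSp m))
    (μhat : Measure (SymbSp m × EucSp D)) (κ : SymbSp m → Measure (EucSp D)) : Prop :=
  ∀ᵐ ω ∂μplus, ∀ A : Set (EucSp D), MeasurableSet A →
    Tendsto (fun n : ℕ => μhat (cyl (word ω n) ×ˢ A) / μplus (cyl (word ω n)))
      atTop (𝓝 (κ ω A))

lemma word_eq_word_iff {m : ℕ} {ω η : SymbSp m} {n : ℕ} :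
    word ω n = word η n ↔ ∀ i < n, ω i = η i := by
  simp [word]

lemma mem_cyl_word_iff {m : ℕ} {ω η : SymbSp m} {n : ℕ} :
    ω ∈ cyl (word η n) ↔ ∀ i < n, ω i = η i := by
  have h : (word η n).length = n := by simp [word]
  rw [cyl, mem_ofPred_eq, h, word_eq_word_iff]

lemma measurableSet_cyl {m : ℕ} (η : SymbSp m) (n : ℕ) : MeasurableSet (cyl (word η n)) := by
  have h : cyl (word η n) = ⋂ i ∈ Finset.range n, (fun ω : SymbSp m => ω i) ⁻¹' {η i} := by
    ext ω
    simp [mem_cyl_word_iff]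
  rw [h]
  exact Finset.measurableSet_biInter _ fun i _ =>
    measurable_pi_apply i (measurableSet_singleton _)

lemma measurable_shift {m : ℕ} : Measurable (shift : SymbSp m → SymbSp m) :=
  measurable_pi_lambda _ fun n => measurable_pi_apply (n + 1)

lemma shift_iterate_apply {m : ℕ} (n : ℕ) (ω : SymbSp m) (i : ℕ) :
    shift^[n] ω i = ω (i + n) := by
  induction n generalizing i with
  | zero => rfl
  | succ n ih =>
    rw [Function.iterate_succ_apply', shift, ih]
    congr 1
    omega

lemma birk_add {m : ℕ} (ψ : SymbSp m → ℝ) (n k : ℕ) (ω : SymbSp m) :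
    birk ψ (n + k) ω = birk ψ n ω + birk ψ k (shift^[n] ω) := by
  simp only [birk, Finset.sum_range_add, ← Function.iterate_add_apply, add_comm]

/-- Gibbs measures are quasi-Bernoulli on cylinders. -/
lemma IsGibbs.exists_quasiBernoulli {m : ℕ} {ψ : SymbSp m → ℝ} {P : ℝ}
    {μ : Measure (SymbSp m)} [IsFiniteMeasure μ] (h : IsGibbs ψ P μ) :
    ∃ K : ℝ≥0, 0 < K ∧ ∀ (ω : SymbSp m) (n k : ℕ),
      μ (cyl (word ω (n + k))) ≤ K * (μ (cyl (word ω n)) * μ (cyl (word (shift^[n] ω) k))) ∧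
      μ (cyl (word ω n)) * μ (cyl (word (shift^[n] ω) k)) ≤ K * μ (cyl (word ω (n + k))) := by
  obtain ⟨C, hC, h⟩ := h
  have hC0 : 0 < C := by linarith
  lift C to ℝ≥0 using hC0.le
  refine ⟨C ^ 3, pow_pos (by exact_mod_cast hC0) 3, fun ω n k => ?_⟩
  obtain ⟨l₁, u₁⟩ := h ω n
  obtain ⟨l₂, u₂⟩ := h (shift^[n] ω) k
  obtain ⟨l₃, u₃⟩ := h ω (n + k)
  have he : Real.exp (birk ψ (n + k) ω - (n + k : ℕ) * P) =
      Real.exp (birk ψ n ω - n * P) * Real.exp (birk ψ k (shift^[n] ω) - k * P) := by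
    rw [← Real.exp_add, birk_add]
    push_cast
    ring_nf
  rw [he] at l₃ u₃
  have e₁ := Real.exp_pos (birk ψ n ω - n * P)
  have e₂ := Real.exp_pos (birk ψ k (shift^[n] ω) - k * P)
  generalize Real.exp (birk ψ n ω - n * P) = a at *
  generalize Real.exp (birk ψ k (shift^[n] ω) - k * P) = b at *
  rw [inv_mul_le_iff₀ hC0] at l₁ l₂ l₃
  constructor
  · rw [← ENNReal.toReal_le_toReal (by finiteness) (by finiteness)]
    simp only [ENNReal.toReal_mul, ENNReal.coe_toReal, NNReal.coe_pow]
    refine u₃.trans ?_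
    calc C * (a * b) ≤ C * ((C * (μ (cyl (word ω n))).toReal) *
          (C * (μ (cyl (word (shift^[n] ω) k))).toReal)) := by gcongr
      _ = _ := by ring
  · rw [← ENNReal.toReal_le_toReal (by finiteness) (by finiteness)]
    simp only [ENNReal.toReal_mul, ENNReal.coe_toReal, NNReal.coe_pow]
    calc _ ≤ (C * a) * (C * b) := by gcongr
      _ = C ^ 2 * (a * b) := by ring
      _ ≤ C ^ 2 * (C * (μ (cyl (word ω (n + k)))).toReal) := by gcongr
      _ = _ := by ring

lemma IsGibbs.measure_cyl_ne_zero {m : ℕ} {ψ : SymbSp m → ℝ} {P : ℝ}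
    {μ : Measure (SymbSp m)} (h : IsGibbs ψ P μ) (ω : SymbSp m) (n : ℕ) :
    μ (cyl (word ω n)) ≠ 0 := by
  obtain ⟨C, hC, h⟩ := h
  intro h0
  have hpos : 0 < C⁻¹ * Real.exp (birk ψ n ω - n * P) := by positivity
  have := (h ω n).1
  rw [h0, ENNReal.toReal_zero] at this
  linarith

/-- A set of sequences that depends only on the first `n` symbols. -/
def DependsOnFirst {m : ℕ} (n : ℕ) (G : Set (SymbSp m)) : Prop :=
  ∀ ω η : SymbSp m, (∀ i < n, ω i = η i) → ω ∈ G → η ∈ G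

/-- The first `n` symbols of a sequence. -/
def firstSymbols {m : ℕ} (n : ℕ) (ω : SymbSp m) : Fin n → Fin m := fun i => ω i

lemma measurable_firstSymbols {m : ℕ} (n : ℕ) :
    Measurable (firstSymbols n : SymbSp m → Fin n → Fin m) :=
  measurable_pi_lambda _ fun i => measurable_pi_apply (i : ℕ)

lemma DependsOnFirst.exists_finset {m n : ℕ} {G : Set (SymbSp m)} (hG : DependsOnFirst n G) :
    ∃ B : Finset (Fin n → Fin m), G = firstSymbols n ⁻¹' (B : Set (Fin n → Fin m)) := by
  classical
  refine ⟨(firstSymbols n '' G).toFinset, ?_⟩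
  ext ω
  simp only [coe_toFinset, mem_preimage, mem_image]
  refine ⟨fun h => ⟨ω, h, rfl⟩, ?_⟩
  rintro ⟨η, hη, h⟩
  exact hG η ω (fun i hi => congrFun h ⟨i, hi⟩) hη

/-- The sequence starting with the word `v` and continuing with `η`. -/
def prependWord {m n : ℕ} (v : Fin n → Fin m) (η : SymbSp m) : SymbSp m :=
  fun i => if h : i < n then v ⟨i, h⟩ else η (i - n)

lemma shift_iterate_prependWord {m n : ℕ} (v : Fin n → Fin m) (η : SymbSp m) :
    shift^[n] (prependWord v η) = η := by
  ext i
  simp [shift_iterate_apply, prependWord]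

lemma firstSymbols_preimage_singleton {m n : ℕ} (v : Fin n → Fin m) (η : SymbSp m) :
    firstSymbols n ⁻¹' {v} = cyl (word (prependWord v η) n) := by
  ext ω
  simp only [mem_preimage, mem_singleton_iff, mem_cyl_word_iff]
  refine ⟨fun h i hi => ?_, fun h => funext fun i => ?_⟩
  · simp [prependWord, hi, ← h, firstSymbols]
  · simp [firstSymbols, h i i.2, prependWord]

lemma firstSymbols_preimage_inter_cyl {m n : ℕ} (v : Fin n → Fin m) (η : SymbSp m) (k : ℕ) :
    firstSymbols n ⁻¹' {v} ∩ shift^[n] ⁻¹' cyl (word η k) =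
      cyl (word (prependWord v η) (n + k)) := by
  ext ω
  rw [firstSymbols_preimage_singleton v η]
  simp only [mem_inter_iff, mem_preimage, mem_cyl_word_iff, shift_iterate_apply]
  refine ⟨fun ⟨h₁, h₂⟩ i hi => ?_, fun h => ⟨fun i hi => h i (by omega), fun i hi => ?_⟩⟩
  · by_cases hin : i < n
    · exact h₁ i hin
    · have := h₂ (i - n) (by omega)
      rw [Nat.sub_add_cancel (by omega)] at this
      simp [this, prependWord, hin]
  · simp [h (i + n) (by omega), prependWord]

/-- The quasi-Bernoulli property for events that depend on finitely many symbols. -/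
lemma IsGibbs.exists_quasiBernoulli_inter {m : ℕ} {ψ : SymbSp m → ℝ} {P : ℝ}
    {μ : Measure (SymbSp m)} [IsFiniteMeasure μ] (h : IsGibbs ψ P μ) :
    ∃ K : ℝ≥0, 0 < K ∧ ∀ (n k : ℕ) (η : SymbSp m) (G : Set (SymbSp m)), DependsOnFirst n G →
      μ (G ∩ shift^[n] ⁻¹' cyl (word η k)) ≤ K * (μ G * μ (cyl (word η k))) ∧
      μ G * μ (cyl (word η k)) ≤ K * μ (G ∩ shift^[n] ⁻¹' cyl (word η k)) := by
  obtain ⟨K, hK, h⟩ := h.exists_quasiBernoulli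
  refine ⟨K, hK, fun n k η G hG => ?_⟩
  obtain ⟨B, rfl⟩ := hG.exists_finset
  have hm : ∀ v ∈ B, MeasurableSet (firstSymbols (m := m) n ⁻¹' {v}) := fun v _ =>
    measurable_firstSymbols n (measurableSet_singleton v)
  have h₁ : μ (firstSymbols n ⁻¹' (B : Set (Fin n → Fin m)) ∩ shift^[n] ⁻¹' cyl (word η k)) =
      ∑ v ∈ B, μ (cyl (word (prependWord v η) (n + k))) := by
    rw [← Measure.restrict_apply (measurable_firstSymbols n B.measurableSet),
      ← sum_measure_preimage_singleton B hm]
    refine Finset.sum_congr rfl fun v hv => ?_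
    rw [Measure.restrict_apply (hm v hv), firstSymbols_preimage_inter_cyl]
  have h₂ : μ (firstSymbols n ⁻¹' (B : Set (Fin n → Fin m))) =
      ∑ v ∈ B, μ (cyl (word (prependWord v η) n)) := by
    rw [← sum_measure_preimage_singleton B hm]
    simp only [firstSymbols_preimage_singleton _ η]
  rw [h₁, h₂, Finset.sum_mul, Finset.mul_sum, Finset.mul_sum]
  refine ⟨Finset.sum_le_sum fun v _ => ?_, Finset.sum_le_sum fun v _ => ?_⟩
  · simpa only [shift_iterate_prependWord] using (h (prependWord v η) n k).1
  · simpa only [shift_iterate_prependWord] using (h (prependWord v η) n k).2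

/-- The action `φ_{ω_n} ∘ … ∘ φ_{ω_1}` of the `n`-th iterate of the skew product on the fiber
over `ω`. -/
def CIFS.fiberMap {D m : ℕ} (S : CIFS D m) : ℕ → SymbSp m → EucSp D → EucSp D
  | 0, _ => id
  | n + 1, ω => S.fiberMap n (shift ω) ∘ S.φ (ω 0)

lemma CIFS.skew_iterate {D m : ℕ} (S : CIFS D m) (n : ℕ) (p : SymbSp m × EucSp D) :
    (skew S)^[n] p = (shift^[n] p.1, S.fiberMap n p.1 p.2) := by
  induction n generalizing p with
  | zero => rfl
  | succ n ih => rw [Function.iterate_succ_apply, ih]; rfl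

lemma CIFS.measurable_skew {D m : ℕ} (S : CIFS D m) : Measurable (skew S) := by
  refine (measurable_shift.comp measurable_fst).prodMk ?_
  have h : Measurable fun q : Fin m × EucSp D => S.φ q.1 q.2 :=
    measurable_from_prod_countable_right S.measurable_φ
  exact h.comp (((measurable_pi_apply (X := fun _ : ℕ => Fin m) 0).comp measurable_fst).prodMk
    measurable_snd)

lemma CIFS.fiberMap_congr {D m : ℕ} (S : CIFS D m) {n : ℕ} {ω η : SymbSp m}
    (h : ∀ i < n, ω i = η i) : S.fiberMap n ω = S.fiberMap n η := by
  induction n generalizing ω η with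
  | zero => rfl
  | succ n ih =>
    rw [fiberMap, fiberMap, h 0 (by omega), ih (ω := shift ω) (η := shift η) fun i hi => h (i + 1) (by omega)]

lemma CIFS.dependsOnFirst_fiberMap {D m : ℕ} (S : CIFS D m) (n : ℕ) (x : EucSp D)
    (F : Set (EucSp D)) : DependsOnFirst n {ω | S.fiberMap n ω x ∈ F} := by
  intro ω η h hω
  rwa [mem_ofPred_eq, ← S.fiberMap_congr h]

lemma CIFS.exists_dist_fiberMap_le_pow {D m : ℕ} (S : CIFS D m) :
    ∃ r : ℝ≥0, r < 1 ∧ ∀ (n : ℕ) (ω : SymbSp m), ∀ x ∈ S.V, ∀ y ∈ S.V,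
      dist (S.fiberMap n ω x) (S.fiberMap n ω y) ≤ r ^ n * dist x y := by
  choose r hr hL using S.contraction
  refine ⟨Finset.univ.sup r, ?_, fun n => ?_⟩
  · rw [Finset.sup_lt_iff (by simp)]
    exact fun i _ => hr i
  induction n with
  | zero => simp [fiberMap]
  | succ n ih =>
    intro ω x hx y hy
    refine (ih (shift ω) _ (S.mapsToV _ hx) _ (S.mapsToV _ hy)).trans ?_
    rw [pow_succ, mul_assoc]
    gcongr
    refine ((hL (ω 0)).dist_le_mul x hx y hy).trans ?_
    gcongr
    exact Finset.le_sup (f := r) (Finset.mem_univ _)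

lemma CIFS.exists_dist_fiberMap_le {D m : ℕ} (S : CIFS D m) {δ : ℝ} (hδ : 0 < δ) :
    ∃ n : ℕ, ∀ ω : SymbSp m, ∀ x ∈ S.V, ∀ y ∈ S.V,
      dist (S.fiberMap n ω x) (S.fiberMap n ω y) ≤ δ := by
  obtain ⟨r, hr, h⟩ := S.exists_dist_fiberMap_le_pow
  have ht : Tendsto (fun n : ℕ => (r : ℝ) ^ n * diam S.V) atTop (𝓝 0) := by
    simpa using (tendsto_pow_atTop_nhds_zero_of_lt_one r.2 (by exact_mod_cast hr)).mul_const
      (diam S.V)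
  obtain ⟨n, hn⟩ := (ht.eventually (gt_mem_nhds hδ)).exists
  refine ⟨n, fun ω x hx y hy => (h n ω x hx y hy).trans (le_trans ?_ hn.le)⟩
  gcongr
  exact dist_le_diam_of_mem S.compactV.isBounded hx hy

lemma CIFS.limitSet_subset {D m : ℕ} (S : CIFS D m) : S.limitSet ⊆ S.V := by
  intro x hx
  obtain ⟨ω, hω⟩ := mem_iUnion.1 hx
  simpa [word, compWord] using mem_iInter.1 hω 0

section Lift

variable {D m : ℕ} {S : CIFS D m} {μplus : Measure (SymbSp m)}
  {μhat : Measure (SymbSp m × EucSp D)}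

lemma CIFS.IsLift.ae_mem_V (h : S.IsLift μplus μhat) : ∀ᵐ p ∂μhat, p.2 ∈ S.V :=
  measure_mono_null (fun _ hp hΛ => hp (S.limitSet_subset hΛ)) h.2.2.2

lemma CIFS.IsLift.measure_iterate_preimage (h : S.IsLift μplus μhat) (n : ℕ)
    {E : Set (SymbSp m × EucSp D)} (hE : MeasurableSet E) :
    μhat {p | (shift^[n] p.1, S.fiberMap n p.1 p.2) ∈ E} = μhat E := by
  have hp : MeasurePreserving (skew S) μhat μhat := ⟨S.measurable_skew, h.2.1⟩
  rw [← (hp.iterate n).measure_preimage hE.nullMeasurableSet]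
  simp only [preimage, S.skew_iterate]

lemma CIFS.IsLift.measure_fst (h : S.IsLift μplus μhat) {E : Set (SymbSp m)}
    (hE : MeasurableSet E) : μplus E = μhat (Prod.fst ⁻¹' E) := by
  rw [← h.2.2.1, Measure.map_apply measurable_fst hE]

lemma DependsOnFirst.measurableSet {n : ℕ} {G : Set (SymbSp m)} (hG : DependsOnFirst n G) :
    MeasurableSet G := by
  obtain ⟨B, rfl⟩ := hG.exists_finset
  exact measurable_firstSymbols n B.measurableSet

/-- Up to a small thickening, the lifted measure of `E ×ˢ F` is computed by following a single
base point `x` of `V` along the skew product. -/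
lemma CIFS.IsLift.exists_measure_prod_compare (h : S.IsLift μplus μhat) {x : EucSp D}
    (hx : x ∈ S.V) {δ : ℝ} (hδ : 0 < δ) :
    ∃ n : ℕ, ∀ (E : Set (SymbSp m)) (F : Set (EucSp D)), MeasurableSet E → IsClosed F →
      μhat (E ×ˢ F) ≤ μplus ({ω | S.fiberMap n ω x ∈ cthickening δ F} ∩ shift^[n] ⁻¹' E) ∧
      μplus ({ω | S.fiberMap n ω x ∈ F} ∩ shift^[n] ⁻¹' E) ≤ μhat (E ×ˢ cthickening δ F) := by
  obtain ⟨n, hn⟩ := S.exists_dist_fiberMap_le hδ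
  have hm : ∀ (E : Set (SymbSp m)) (F : Set (EucSp D)), MeasurableSet E →
      MeasurableSet ({ω | S.fiberMap n ω x ∈ F} ∩ shift^[n] ⁻¹' E) := fun E F hE =>
    (S.dependsOnFirst_fiberMap n x F).measurableSet.inter (measurable_shift.iterate n hE)
  refine ⟨n, fun E F hE hF => ⟨?_, ?_⟩⟩
  · rw [← h.measure_iterate_preimage n (hE.prod hF.measurableSet), h.measure_fst (hm _ _ hE)]
    refine measure_mono_ae ?_
    filter_upwards [h.ae_mem_V] with p hp hpE
    exact ⟨mem_cthickening_of_dist_le _ _ _ _ hpE.2 (hn p.1 x hx p.2 hp), hpE.1⟩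
  · rw [← h.measure_iterate_preimage n (hE.prod isClosed_cthickening.measurableSet),
      h.measure_fst (hm _ _ hE)]
    refine measure_mono_ae ?_
    filter_upwards [h.ae_mem_V] with p hp hpE
    exact ⟨hpE.2, mem_cthickening_of_dist_le _ _ _ _ hpE.1 (hn p.1 p.2 hp x hx)⟩

end Lift

lemma MeasureTheory.Measure.le_of_forall_isClosed {X : Type*} [TopologicalSpace X]
    [MeasurableSpace X] [BorelSpace X] [TopologicalSpace.PseudoMetrizableSpace X] {μ ν : Measure X}
    [IsFiniteMeasure μ] (h : ∀ F, IsClosed F → μ F ≤ ν F) : μ ≤ ν := by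
  refine Measure.le_iff.2 fun A hA => ?_
  rw [hA.measure_eq_iSup_isClosed_of_ne_top (by finiteness)]
  exact iSup₂_le fun F hFA => iSup_le fun hF => (h F hF).trans (measure_mono hFA)

lemma le_measure_of_forall_le_cthickening {X : Type*} [PseudoMetricSpace X] [MeasurableSpace X]
    [OpensMeasurableSpace X] {μ : Measure X} [IsFiniteMeasure μ] {F : Set X} (hF : IsClosed F)
    {a : ℝ≥0∞} (h : ∀ δ > 0, a ≤ μ (cthickening δ F)) : a ≤ μ F := by
  have ht := tendsto_measure_cthickening_of_isClosed (μ := μ) ⟨1, one_pos, by finiteness⟩ hF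
  refine ge_of_tendsto (ht.mono_left (nhdsWithin_le_nhds (s := Ioi 0))) ?_
  filter_upwards [self_mem_nhdsWithin] with δ hδ using h δ hδ

/-- The lift of a Gibbs measure is comparable to a product on each `cylinder × Borel set`. -/
lemma CIFS.IsLift.exists_measure_cyl_prod_compare {D m : ℕ} {S : CIFS D m} {ψ : SymbSp m → ℝ}
    {P : ℝ} {μplus : Measure (SymbSp m)} {μhat : Measure (SymbSp m × EucSp D)}
    (h : S.IsLift μplus μhat) (hG : IsGibbs ψ P μplus) [IsFiniteMeasure μplus] :
    ∃ K : ℝ≥0, 0 < K ∧ ∀ (η : SymbSp m) (k : ℕ) (A : Set (EucSp D)), MeasurableSet A →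
      μhat (cyl (word η k) ×ˢ A) ≤ K * (μhat.snd A * μplus (cyl (word η k))) ∧
      μhat.snd A * μplus (cyl (word η k)) ≤ K * μhat (cyl (word η k) ×ˢ A) := by
  have := h.1
  obtain ⟨K, hK, hq⟩ := hG.exists_quasiBernoulli_inter
  obtain ⟨x, hx⟩ := S.interiorV.mono interior_subset
  refine ⟨K, hK, fun η k => ?_⟩
  set E := cyl (word η k)
  have hE : MeasurableSet E := measurableSet_cyl η k
  have hsnd : ∀ A : Set (EucSp D), MeasurableSet A → μhat (univ ×ˢ A) = μhat.snd A := fun A hA => by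
    rw [Measure.snd_apply hA, univ_prod]
  have hrestr : ∀ A : Set (EucSp D), MeasurableSet A →
      μhat (E ×ˢ A) = (μhat.restrict (E ×ˢ univ)).snd A := fun A hA => by
    rw [Measure.snd_apply hA, Measure.restrict_apply (measurable_snd hA)]
    congr 1
    ext p
    simp [and_comm]
  have hsub : ∀ {δ : ℝ} (F : Set (EucSp D)), 0 < δ →
      cthickening (δ / 2) (cthickening (δ / 2) F) ⊆ cthickening δ F := fun {δ} F hδ => by
    simpa using cthickening_cthickening_subset (half_pos hδ).le (half_pos hδ).le F
  have hle : (μhat.restrict (E ×ˢ univ)).snd ≤ (K * μplus E) • μhat.snd := by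
    have : IsFiniteMeasure ((K * μplus E) • μhat.snd) :=
      Measure.smul_finite _ (by finiteness)
    refine Measure.le_of_forall_isClosed fun F hF =>
      le_measure_of_forall_le_cthickening hF fun δ hδ => ?_
    obtain ⟨n, hn⟩ := h.exists_measure_prod_compare hx (half_pos hδ)
    have h₂ := (hn univ (cthickening (δ / 2) F) .univ isClosed_cthickening).2
    rw [preimage_univ, inter_univ, hsnd _ isClosed_cthickening.measurableSet] at h₂
    rw [← hrestr F hF.measurableSet, Measure.smul_apply, smul_eq_mul]
    calc μhat (E ×ˢ F) ≤ _ := (hn E F hE hF).1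
      _ ≤ _ := (hq n k η _ (S.dependsOnFirst_fiberMap n x _)).1
      _ ≤ K * (μhat.snd (cthickening δ F) * μplus E) := by
        gcongr
        exact h₂.trans (measure_mono (hsub F hδ))
      _ = _ := by ring
  have hge : μplus E • μhat.snd ≤ (K : ℝ≥0∞) • (μhat.restrict (E ×ˢ univ)).snd := by
    have : IsFiniteMeasure (μplus E • μhat.snd) := Measure.smul_finite _ (by finiteness)
    have : IsFiniteMeasure ((K : ℝ≥0∞) • (μhat.restrict (E ×ˢ univ)).snd) :=
      Measure.smul_finite _ (by finiteness)
    refine Measure.le_of_forall_isClosed fun F hF =>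
      le_measure_of_forall_le_cthickening hF fun δ hδ => ?_
    obtain ⟨n, hn⟩ := h.exists_measure_prod_compare hx (half_pos hδ)
    have h₁ := (hn univ F .univ hF).1
    rw [preimage_univ, inter_univ, hsnd _ hF.measurableSet] at h₁
    rw [Measure.smul_apply, Measure.smul_apply, smul_eq_mul, smul_eq_mul,
      ← hrestr _ isClosed_cthickening.measurableSet]
    calc μplus E * μhat.snd F
        ≤ μplus E * μplus {ω | S.fiberMap n ω x ∈ cthickening (δ / 2) F} := by gcongr
      _ = _ := mul_comm _ _
      _ ≤ _ := (hq n k η _ (S.dependsOnFirst_fiberMap n x _)).2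
      _ ≤ K * μhat (E ×ˢ cthickening (δ / 2) (cthickening (δ / 2) F)) := by
        gcongr
        exact (hn E _ hE isClosed_cthickening).2
      _ ≤ _ := by
        gcongr
        exact hsub F hδ
  intro A hA
  rw [hrestr A hA]
  have h₁ := hle A
  have h₂ := hge A
  simp only [Measure.smul_apply, smul_eq_mul] at h₁ h₂
  exact ⟨h₁.trans_eq (by ring), (mul_comm _ _).trans_le h₂⟩

/-- first part of Lemma 1 of the paper. For the conditional
measures `{μ_ω}` of the equilibrium measure `μ̂` of `ψ∘π₁` on the fibers `{ω}×Λ`,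
there is `C > 0` such that for `μ⁺`-a.e. `ω, η` and every Borel `A ⊆ Λ`,
`(1/C)·μ_η(A) ≤ μ_ω(A) ≤ C·μ_η(A)`. -/
theorem statement7 {D m : ℕ} (hD : 1 ≤ D) (hm : 1 ≤ m) (S : CIFS D m)
    (ψ : SymbSp m → ℝ) (hψ : HolderPotential ψ) (P : ℝ)
    (μplus : Measure (SymbSp m)) (hμplus : IsEquilibrium ψ P μplus)
    (μhat : Measure (SymbSp m × EucSp D)) (hμhat : S.IsLift μplus μhat)
    (κ : SymbSp m → Measure (EucSp D)) (hκ : IsCondSystem μplus μhat κ) :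
    ∃ C : ℝ≥0, 0 < C ∧ ∀ᵐ ω ∂μplus, ∀ᵐ η ∂μplus,
      ∀ A : Set (EucSp D), A ⊆ S.limitSet → MeasurableSet A →
        (C : ℝ≥0∞)⁻¹ * κ η A ≤ κ ω A ∧ κ ω A ≤ (C : ℝ≥0∞) * κ η A := by
  have := hμplus.1
  obtain ⟨K, hK, hcmp⟩ := hμhat.exists_measure_cyl_prod_compare hμplus.2.2
  have hK0 : (K : ℝ≥0∞) ≠ 0 := by exact_mod_cast hK.ne'
  have hbound : ∀ᵐ ω ∂μplus, ∀ A : Set (EucSp D), MeasurableSet A →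
      κ ω A ≤ K * μhat.snd A ∧ μhat.snd A ≤ K * κ ω A := by
    filter_upwards [hκ] with ω hω A hA
    have hne := hμplus.2.2.measure_cyl_ne_zero ω
    constructor
    · refine le_of_tendsto (hω A hA) (Eventually.of_forall fun n => ENNReal.div_le_of_le_mul ?_)
      simpa only [mul_assoc] using (hcmp ω n A hA).1
    · refine ge_of_tendsto (ENNReal.Tendsto.const_mul (hω A hA) (.inr ENNReal.coe_ne_top))
        (Eventually.of_forall fun n => ?_)
      rw [← mul_div_assoc, ENNReal.le_div_iff_mul_le (.inl (hne n)) (.inl (by finiteness))]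
      exact (hcmp ω n A hA).2
  refine ⟨K * K, by positivity, ?_⟩
  filter_upwards [hbound] with ω hω
  filter_upwards [hbound] with η hη A _ hA
  have hle : ∀ ω' η' : SymbSp m, κ ω' A ≤ K * μhat.snd A → μhat.snd A ≤ K * κ η' A →
      κ ω' A ≤ (K * K : ℝ≥0) * κ η' A := fun ω' η' h₁ h₂ => by
    rw [ENNReal.coe_mul, mul_assoc]
    exact h₁.trans (by gcongr)
  refine ⟨?_, hle ω η (hω A hA).1 (hη A hA).2⟩
  rw [mul_comm, ← ENNReal.div_eq_inv_mul.trans (mul_comm _ _)]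
  exact ENNReal.div_le_of_le_mul' (hle η ω (hη A hA).1 (hω A hA).2)
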